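/- Let G be a finite group and let g, h ∈ G with g ∉ Z(G) and h ∉ Z(G). If Z(g) ⊓ Z(h) ≠ Z(G), then Z(g) ⊓ Z(h) equals the join (the subgroup generated by the union) of the subgroups Z(c), where c ranges over the elements of (Z(g) ⊓ Z(h)) \ Z(G). -/

import Mathlib

/-- `Z(g) = Z(C_G(g))` regarded as a subgroup of `G`; since `g ∈ C_G(g)`, this equals
the centralizer of `C_G(g)` in `G`. -/
def zCent (G : Type*) [Group G] (g : G) : Subgroup G :=
  Subgroup.centralizer ((Subgroup.centralizer ({g} : Set G) : Subgroup G) : Set G)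

theorem mem_zCent_self (G : Type*) [Group G] (g : G) : g ∈ zCent G g :=
  Subgroup.mem_centralizer_iff.2 fun _ hx =>
    (Subgroup.mem_centralizer_iff.1 hx g rfl).symm

theorem center_le_zCent (G : Type*) [Group G] (g : G) : Subgroup.center G ≤ zCent G g :=
  Subgroup.center_le_centralizer _

theorem zCent_le_of_mem {G : Type*} [Group G] {g c : G} (hc : c ∈ zCent G g) :
    zCent G c ≤ zCent G g := by
  refine Subgroup.centralizer_le fun x hx => Subgroup.mem_centralizer_iff.2 ?_
  rintro _ rfl
  exact (Subgroup.mem_centralizer_iff.1 hc x hx).symm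

theorem stmt_5 (G : Type*) [Group G] [Fintype G] (g h : G)
    (hg : g ∉ Subgroup.center G) (hh : h ∉ Subgroup.center G)
    (hne : zCent G g ⊓ zCent G h ≠ Subgroup.center G) :
    zCent G g ⊓ zCent G h =
      ⨆ c ∈ ((zCent G g ⊓ zCent G h : Subgroup G) : Set G) \
        ((Subgroup.center G : Subgroup G) : Set G), zCent G c := by
  apply le_antisymm
  · intro x hx
    by_cases hxc : x ∈ Subgroup.center G
    · have hlt : Subgroup.center G < zCent G g ⊓ zCent G h :=
        lt_of_le_of_ne (le_inf (center_le_zCent G g) (center_le_zCent G h)) hne.symm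
      obtain ⟨c, hc, hcc⟩ := SetLike.exists_of_lt hlt
      exact le_iSup₂ (f := fun c _ => zCent G c) c ⟨hc, hcc⟩ (center_le_zCent G c hxc)
    · exact le_iSup₂ (f := fun c _ => zCent G c) x ⟨hx, hxc⟩ (mem_zCent_self G x)
  · exact iSup₂_le fun c hc => le_inf (zCent_le_of_mem hc.1.1) (zCent_le_of_mem hc.1.2)
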